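/- Let ρ_AB be a bipartite density matrix and suppose the complete projective measurement {P_i} attains C_HV(ρ_AB). Let ρ'_AB = ∑_i (P_i ⊗ 1) ρ_AB (P_i ⊗ 1). Then each P_i commutes with the reduced state Tr_B ρ'_AB, one has δ_cl^→(ρ'_AB,{P_i}) = c_HV(ρ'_AB,{P_i}) = C_HV(ρ_AB), and consequently Δ_cl^→(ρ'_AB) ≥ C_HV(ρ_AB). -/

import Mathlib

open Matrix Kronecker
open scoped ComplexOrder

noncomputable section

/-- von Neumann entropy (natural logarithm): `S(ρ) = -∑ λ_k log λ_k`. -/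
def vnEntropy {d : ℕ} (ρ : Matrix (Fin d) (Fin d) ℂ) : ℝ :=
  if h : ρ.IsHermitian then -∑ k, h.eigenvalues k * Real.log (h.eigenvalues k) else 0

/-- von Neumann entropy in bits (log base 2). -/
def vnEntropy2 {d : ℕ} (ρ : Matrix (Fin d) (Fin d) ℂ) : ℝ :=
  if h : ρ.IsHermitian then -∑ k, h.eigenvalues k * Real.logb 2 (h.eigenvalues k) else 0

/-- A density matrix: positive semidefinite with unit trace. -/
def IsDensityMatrix {n : Type} [Fintype n] [DecidableEq n] (ρ : Matrix n n ℂ) : Prop :=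
  ρ.PosSemidef ∧ ρ.trace = 1

/-- Partial trace over the B system. -/
def ptraceB {dA dB : ℕ} (ρ : Matrix (Fin dA × Fin dB) (Fin dA × Fin dB) ℂ) :
    Matrix (Fin dA) (Fin dA) ℂ :=
  Matrix.of fun a a' => ∑ b, ρ (a, b) (a', b)

/-- Partial trace over the A system. -/
def ptraceA {dA dB : ℕ} (ρ : Matrix (Fin dA × Fin dB) (Fin dA × Fin dB) ℂ) :
    Matrix (Fin dB) (Fin dB) ℂ :=
  Matrix.of fun b b' => ∑ a, ρ (a, b) (a, b')

/-- A projective measurement on `ℂ^{dA}`: a finite family of mutually orthogonal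
orthogonal projectors summing to the identity. -/
structure ProjMeas (dA m : ℕ) where
  P : Fin m → Matrix (Fin dA) (Fin dA) ℂ
  herm : ∀ i, (P i).IsHermitian
  idem : ∀ i, P i * P i = P i
  orth : ∀ i j, i ≠ j → P i * P j = 0
  sum_eq : ∑ i, P i = 1

/-- A measurement is complete if all projectors are rank one. -/
def ProjMeas.Complete {dA m : ℕ} (M : ProjMeas dA m) : Prop :=
  ∀ i, (M.P i).rank = 1

/-- Outcome probability `p_i = Tr[(P_i ⊗ 1) ρ]`. -/
def prob {dA dB m : ℕ} (ρ : Matrix (Fin dA × Fin dB) (Fin dA × Fin dB) ℂ)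
    (M : ProjMeas dA m) (i : Fin m) : ℝ :=
  (((M.P i ⊗ₖ (1 : Matrix (Fin dB) (Fin dB) ℂ)) * ρ).trace).re

/-- Conditional state of Bob: `Tr_A[(P_i ⊗ 1) ρ (P_i ⊗ 1)] / p_i`. -/
def condB {dA dB m : ℕ} (ρ : Matrix (Fin dA × Fin dB) (Fin dA × Fin dB) ℂ)
    (M : ProjMeas dA m) (i : Fin m) : Matrix (Fin dB) (Fin dB) ℂ :=
  ((prob ρ M i : ℂ))⁻¹ •
    ptraceA ((M.P i ⊗ₖ (1 : Matrix (Fin dB) (Fin dB) ℂ)) * ρ *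
      (M.P i ⊗ₖ (1 : Matrix (Fin dB) (Fin dB) ℂ)))

/-- `c_HV(ρ,{P_i}) = S(ρ_B) - ∑_i p_i S(ρ_i^B)`. -/
def cHV {dA dB m : ℕ} (ρ : Matrix (Fin dA × Fin dB) (Fin dA × Fin dB) ℂ)
    (M : ProjMeas dA m) : ℝ :=
  vnEntropy (ptraceA ρ) - ∑ i, prob ρ M i * vnEntropy (condB ρ M i)

/-- Same, in bits. -/
def cHV2 {dA dB m : ℕ} (ρ : Matrix (Fin dA × Fin dB) (Fin dA × Fin dB) ℂ)
    (M : ProjMeas dA m) : ℝ :=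
  vnEntropy2 (ptraceA ρ) - ∑ i, prob ρ M i * vnEntropy2 (condB ρ M i)

/-- Dephasing of a single-system state: `∑_i P_i σ P_i`. -/
def deph {d m : ℕ} (σ : Matrix (Fin d) (Fin d) ℂ) (M : ProjMeas d m) :
    Matrix (Fin d) (Fin d) ℂ :=
  ∑ i, M.P i * σ * M.P i

/-- `δ_cl^→(ρ,{P_i}) = S(ρ_A) - S(ρ'_A) + c_HV(ρ,{P_i})`. -/
def deltaCl {dA dB m : ℕ} (ρ : Matrix (Fin dA × Fin dB) (Fin dA × Fin dB) ℂ)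
    (M : ProjMeas dA m) : ℝ :=
  vnEntropy (ptraceB ρ) - vnEntropy (deph (ptraceB ρ) M) + cHV ρ M

/-- The Henderson–Vedral quantity: supremum of `c_HV` over complete projective measurements. -/
def CHV {dA dB : ℕ} (ρ : Matrix (Fin dA × Fin dB) (Fin dA × Fin dB) ℂ) : ℝ :=
  sSup {x : ℝ | ∃ m, ∃ M : ProjMeas dA m, M.Complete ∧ x = cHV ρ M}

/-- One-way classical information deficit: supremum of `δ_cl^→` over complete
projective measurements. -/
def DeltaCl {dA dB : ℕ} (ρ : Matrix (Fin dA × Fin dB) (Fin dA × Fin dB) ℂ) : ℝ :=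
  sSup {x : ℝ | ∃ m, ∃ M : ProjMeas dA m, M.Complete ∧ x = deltaCl ρ M}

/-- Alice-side dephasing of a bipartite state: `∑_i (P_i ⊗ 1) ρ (P_i ⊗ 1)`. -/
def dephAB {dA dB m : ℕ} (ρ : Matrix (Fin dA × Fin dB) (Fin dA × Fin dB) ℂ)
    (M : ProjMeas dA m) : Matrix (Fin dA × Fin dB) (Fin dA × Fin dB) ℂ :=
  ∑ i, (M.P i ⊗ₖ (1 : Matrix (Fin dB) (Fin dB) ℂ)) * ρ *
    (M.P i ⊗ₖ (1 : Matrix (Fin dB) (Fin dB) ℂ))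

/-- Outer product `|v⟩⟨v|`. -/
def outer {n : Type} [Fintype n] (v : n → ℂ) : Matrix n n ℂ :=
  Matrix.of fun x y => v x * star (v y)

lemma kroneckerOne_mul_apply {dA dB : ℕ} (X : Matrix (Fin dA) (Fin dA) ℂ)
    (σ : Matrix (Fin dA × Fin dB) (Fin dA × Fin dB) ℂ) (a : Fin dA) (b : Fin dB)
    (y : Fin dA × Fin dB) :
    ((X ⊗ₖ (1 : Matrix (Fin dB) (Fin dB) ℂ)) * σ) (a, b) y = ∑ c, X a c * σ (c, b) y := by
  simp [Matrix.mul_apply, Fintype.sum_prod_type, Matrix.one_apply]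

lemma mul_kroneckerOne_apply {dA dB : ℕ} (X : Matrix (Fin dA) (Fin dA) ℂ)
    (σ : Matrix (Fin dA × Fin dB) (Fin dA × Fin dB) ℂ) (a : Fin dA) (b : Fin dB)
    (y : Fin dA × Fin dB) :
    (σ * (X ⊗ₖ (1 : Matrix (Fin dB) (Fin dB) ℂ))) y (a, b) = ∑ c, σ y (c, b) * X c a := by
  simp [Matrix.mul_apply, Fintype.sum_prod_type, Matrix.one_apply]

lemma ptraceA_mul_kroneckerOne {dA dB : ℕ} (Y : Matrix (Fin dA) (Fin dA) ℂ)
    (σ : Matrix (Fin dA × Fin dB) (Fin dA × Fin dB) ℂ) :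
    ptraceA (σ * (Y ⊗ₖ (1 : Matrix (Fin dB) (Fin dB) ℂ))) =
      ptraceA ((Y ⊗ₖ (1 : Matrix (Fin dB) (Fin dB) ℂ)) * σ) := by
  ext b b'
  simp only [ptraceA, Matrix.of_apply, kroneckerOne_mul_apply, mul_kroneckerOne_apply]
  rw [Finset.sum_comm]
  simp only [mul_comm]

lemma ptraceB_kroneckerOne_mul {dA dB : ℕ} (X : Matrix (Fin dA) (Fin dA) ℂ)
    (σ : Matrix (Fin dA × Fin dB) (Fin dA × Fin dB) ℂ) :
    ptraceB ((X ⊗ₖ (1 : Matrix (Fin dB) (Fin dB) ℂ)) * σ) = X * ptraceB σ := by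
  ext a a'
  simp only [ptraceB, Matrix.of_apply, kroneckerOne_mul_apply]
  simp only [Matrix.mul_apply, Matrix.of_apply, Finset.mul_sum]
  rw [Finset.sum_comm]

lemma ptraceB_mul_kroneckerOne {dA dB : ℕ} (Y : Matrix (Fin dA) (Fin dA) ℂ)
    (σ : Matrix (Fin dA × Fin dB) (Fin dA × Fin dB) ℂ) :
    ptraceB (σ * (Y ⊗ₖ (1 : Matrix (Fin dB) (Fin dB) ℂ))) = ptraceB σ * Y := by
  ext a a'
  simp only [ptraceB, Matrix.of_apply, mul_kroneckerOne_apply]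
  simp only [Matrix.mul_apply, Matrix.of_apply, Finset.sum_mul]
  rw [Finset.sum_comm]

lemma ptraceA_sum {dA dB : ℕ} {ι : Type*} (s : Finset ι)
    (σ : ι → Matrix (Fin dA × Fin dB) (Fin dA × Fin dB) ℂ) :
    ptraceA (∑ i ∈ s, σ i) = ∑ i ∈ s, ptraceA (σ i) := by
  ext b b'
  simp only [ptraceA, Matrix.of_apply, Matrix.sum_apply]
  rw [Finset.sum_comm]

lemma ptraceB_sum {dA dB : ℕ} {ι : Type*} (s : Finset ι)
    (σ : ι → Matrix (Fin dA × Fin dB) (Fin dA × Fin dB) ℂ) :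
    ptraceB (∑ i ∈ s, σ i) = ∑ i ∈ s, ptraceB (σ i) := by
  ext b b'
  simp only [ptraceB, Matrix.of_apply, Matrix.sum_apply]
  rw [Finset.sum_comm]

lemma trace_ptraceA {dA dB : ℕ} (σ : Matrix (Fin dA × Fin dB) (Fin dA × Fin dB) ℂ) :
    (ptraceA σ).trace = σ.trace := by
  simp only [Matrix.trace, Matrix.diag_apply, ptraceA, Matrix.of_apply, Fintype.sum_prod_type]
  rw [Finset.sum_comm]

lemma trace_ptraceB {dA dB : ℕ} (σ : Matrix (Fin dA × Fin dB) (Fin dA × Fin dB) ℂ) :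
    (ptraceB σ).trace = σ.trace := by
  simp only [Matrix.trace, Matrix.diag_apply, ptraceB, Matrix.of_apply, Fintype.sum_prod_type]

lemma posSemidef_ptraceA {dA dB : ℕ} {σ : Matrix (Fin dA × Fin dB) (Fin dA × Fin dB) ℂ}
    (hσ : σ.PosSemidef) : (ptraceA σ).PosSemidef := by
  have h : ptraceA σ = ∑ a, σ.submatrix (fun b => (a, b)) (fun b => (a, b)) := by
    ext b b'
    simp [ptraceA, Matrix.sum_apply]
  rw [h]
  exact Matrix.posSemidef_sum _ fun a _ => hσ.submatrix _

lemma posSemidef_ptraceB {dA dB : ℕ} {σ : Matrix (Fin dA × Fin dB) (Fin dA × Fin dB) ℂ}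
    (hσ : σ.PosSemidef) : (ptraceB σ).PosSemidef := by
  have h : ptraceB σ = ∑ b, σ.submatrix (fun a => (a, b)) (fun a => (a, b)) := by
    ext a a'
    simp [ptraceB, Matrix.sum_apply]
  rw [h]
  exact Matrix.posSemidef_sum _ fun a _ => hσ.submatrix _

lemma vnEntropy_nonneg {d : ℕ} {σ : Matrix (Fin d) (Fin d) ℂ} (hσ : IsDensityMatrix σ) :
    0 ≤ vnEntropy σ := by
  have hH := hσ.1.isHermitian
  rw [vnEntropy, dif_pos hH, neg_nonneg]
  have hsum : ∑ k, hH.eigenvalues k = 1 := by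
    have := hH.trace_eq_sum_eigenvalues
    rw [hσ.2] at this
    refine Complex.ofReal_injective ?_
    rw [Complex.ofReal_sum]
    exact this.symm
  have hnn := hσ.1.eigenvalues_nonneg
  refine Finset.sum_nonpos fun k hk => mul_nonpos_of_nonneg_of_nonpos (hnn k) ?_
  refine Real.log_nonpos (hnn k) (hsum ▸ ?_)
  exact Finset.single_le_sum (fun j _ => hnn j) hk

namespace ProjMeas

variable {dA dB m : ℕ} (M : ProjMeas dA m)

lemma deph_deph (σ : Matrix (Fin dA) (Fin dA) ℂ) : deph (deph σ M) M = deph σ M := by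
  refine Finset.sum_congr rfl fun i _ => ?_
  rw [deph, Finset.mul_sum, Finset.sum_mul, Finset.sum_eq_single i]
  · simp only [← mul_assoc, M.idem]
    rw [mul_assoc, M.idem]
  · intro j _ hj
    simp only [← mul_assoc, M.orth i j hj.symm, zero_mul]
  · simp

lemma commute_deph (σ : Matrix (Fin dA) (Fin dA) ℂ) (i : Fin m) :
    M.P i * deph σ M = deph σ M * M.P i := by
  rw [deph, Finset.mul_sum, Finset.sum_mul, Finset.sum_eq_single i, Finset.sum_eq_single i]
  · rw [mul_assoc, mul_assoc, mul_assoc, M.idem, ← mul_assoc, M.idem]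
  · intro j _ hj
    rw [mul_assoc, M.orth j i hj, mul_zero]
  · simp
  · intro j _ hj
    simp only [← mul_assoc, M.orth i j hj.symm, zero_mul]
  · simp

lemma posSemidef_deph {σ : Matrix (Fin dA) (Fin dA) ℂ} (hσ : σ.PosSemidef) :
    (deph σ M).PosSemidef := by
  refine Matrix.posSemidef_sum _ fun i _ => ?_
  simpa only [(M.herm i).eq] using hσ.mul_mul_conjTranspose_same (M.P i)

lemma trace_deph (σ : Matrix (Fin dA) (Fin dA) ℂ) : (deph σ M).trace = σ.trace := by
  have h : ∀ i, (M.P i * σ * M.P i).trace = (M.P i * σ).trace := fun i => by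
    rw [Matrix.trace_mul_comm, ← mul_assoc, M.idem]
  rw [deph, Matrix.trace_sum, Finset.sum_congr rfl fun i _ => h i, ← Matrix.trace_sum,
    ← Finset.sum_mul, M.sum_eq, one_mul]

lemma isDensityMatrix_deph {σ : Matrix (Fin dA) (Fin dA) ℂ} (hσ : IsDensityMatrix σ) :
    IsDensityMatrix (deph σ M) :=
  ⟨M.posSemidef_deph hσ.1, (M.trace_deph σ).trans hσ.2⟩

lemma kroneckerOne_mul_kroneckerOne (i j : Fin m) :
    (M.P i ⊗ₖ (1 : Matrix (Fin dB) (Fin dB) ℂ)) * (M.P j ⊗ₖ (1 : Matrix (Fin dB) (Fin dB) ℂ)) =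
      if i = j then M.P i ⊗ₖ (1 : Matrix (Fin dB) (Fin dB) ℂ) else 0 := by
  rw [← Matrix.mul_kronecker_mul, one_mul]
  split_ifs with h
  · rw [← h, M.idem]
  · rw [M.orth i j h, Matrix.zero_kronecker]

lemma posSemidef_outcome {σ : Matrix (Fin dA × Fin dB) (Fin dA × Fin dB) ℂ}
    (hσ : σ.PosSemidef) (i : Fin m) :
    ((M.P i ⊗ₖ (1 : Matrix (Fin dB) (Fin dB) ℂ)) * σ *
      (M.P i ⊗ₖ (1 : Matrix (Fin dB) (Fin dB) ℂ))).PosSemidef := by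
  have h := hσ.mul_mul_conjTranspose_same (M.P i ⊗ₖ (1 : Matrix (Fin dB) (Fin dB) ℂ))
  rwa [Matrix.conjTranspose_kronecker, (M.herm i).eq, Matrix.conjTranspose_one] at h

lemma trace_outcome (σ : Matrix (Fin dA × Fin dB) (Fin dA × Fin dB) ℂ) (i : Fin m) :
    ((M.P i ⊗ₖ (1 : Matrix (Fin dB) (Fin dB) ℂ)) * σ *
      (M.P i ⊗ₖ (1 : Matrix (Fin dB) (Fin dB) ℂ))).trace =
    ((M.P i ⊗ₖ (1 : Matrix (Fin dB) (Fin dB) ℂ)) * σ).trace := by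
  rw [Matrix.trace_mul_comm, ← mul_assoc, M.kroneckerOne_mul_kroneckerOne, if_pos rfl]

lemma prob_nonneg {σ : Matrix (Fin dA × Fin dB) (Fin dA × Fin dB) ℂ}
    (hσ : σ.PosSemidef) (i : Fin m) : 0 ≤ prob σ M i := by
  rw [prob, ← M.trace_outcome]
  exact (Complex.le_def.1 (M.posSemidef_outcome hσ i).trace_nonneg).1

lemma ofReal_prob {σ : Matrix (Fin dA × Fin dB) (Fin dA × Fin dB) ℂ}
    (hσ : σ.PosSemidef) (i : Fin m) :
    (prob σ M i : ℂ) = ((M.P i ⊗ₖ (1 : Matrix (Fin dB) (Fin dB) ℂ)) * σ *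
      (M.P i ⊗ₖ (1 : Matrix (Fin dB) (Fin dB) ℂ))).trace := by
  rw [prob, ← M.trace_outcome]
  have h := (Complex.le_def.1 (M.posSemidef_outcome hσ i).trace_nonneg).2
  exact Complex.ext rfl (by simpa using h)

lemma isDensityMatrix_condB {σ : Matrix (Fin dA × Fin dB) (Fin dA × Fin dB) ℂ}
    (hσ : σ.PosSemidef) {i : Fin m} (hi : prob σ M i ≠ 0) : IsDensityMatrix (condB σ M i) := by
  refine ⟨(posSemidef_ptraceA (M.posSemidef_outcome hσ i)).smul ?_, ?_⟩
  · rw [← Complex.ofReal_inv]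
    exact_mod_cast inv_nonneg.2 (M.prob_nonneg hσ i)
  · rw [condB, Matrix.trace_smul, trace_ptraceA, ← M.ofReal_prob hσ, smul_eq_mul]
    exact inv_mul_cancel₀ (by exact_mod_cast hi)

lemma cHV_le {σ : Matrix (Fin dA × Fin dB) (Fin dA × Fin dB) ℂ} (hσ : σ.PosSemidef) :
    cHV σ M ≤ vnEntropy (ptraceA σ) := by
  refine sub_le_self _ (Finset.sum_nonneg fun i _ => ?_)
  by_cases hi : prob σ M i = 0
  · simp [hi]
  · exact mul_nonneg (M.prob_nonneg hσ i) (vnEntropy_nonneg (M.isDensityMatrix_condB hσ hi))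

lemma deltaCl_le {σ : Matrix (Fin dA × Fin dB) (Fin dA × Fin dB) ℂ} (hσ : IsDensityMatrix σ) :
    deltaCl σ M ≤ vnEntropy (ptraceB σ) + vnEntropy (ptraceA σ) := by
  have hA : IsDensityMatrix (ptraceB σ) :=
    ⟨posSemidef_ptraceB hσ.1, (trace_ptraceB σ).trans hσ.2⟩
  have h := vnEntropy_nonneg (M.isDensityMatrix_deph hA)
  exact add_le_add (sub_le_self _ h) (M.cHV_le hσ.1)

lemma ptraceB_dephAB (σ : Matrix (Fin dA × Fin dB) (Fin dA × Fin dB) ℂ) :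
    ptraceB (dephAB σ M) = deph (ptraceB σ) M := by
  simp only [dephAB, deph, ptraceB_sum, ptraceB_mul_kroneckerOne, ptraceB_kroneckerOne_mul]

lemma ptraceA_dephAB (σ : Matrix (Fin dA × Fin dB) (Fin dA × Fin dB) ℂ) :
    ptraceA (dephAB σ M) = ptraceA σ := by
  have h : ∑ i, M.P i ⊗ₖ (1 : Matrix (Fin dB) (Fin dB) ℂ) = 1 := by
    ext ⟨a, b⟩ ⟨a', b'⟩
    rw [Matrix.sum_apply, ← Matrix.one_kronecker_one, ← M.sum_eq]
    simp [Matrix.kroneckerMap_apply, Matrix.sum_apply, Finset.sum_mul]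
  simp only [dephAB, ptraceA_sum, ptraceA_mul_kroneckerOne, ← mul_assoc,
    M.kroneckerOne_mul_kroneckerOne, if_pos]
  rw [← ptraceA_sum, ← Finset.sum_mul, h, one_mul]

lemma isDensityMatrix_dephAB {σ : Matrix (Fin dA × Fin dB) (Fin dA × Fin dB) ℂ}
    (hσ : IsDensityMatrix σ) : IsDensityMatrix (dephAB σ M) :=
  ⟨Matrix.posSemidef_sum _ fun i _ => M.posSemidef_outcome hσ.1 i,
    by rw [← trace_ptraceA, M.ptraceA_dephAB, trace_ptraceA, hσ.2]⟩

lemma outcome_dephAB (σ : Matrix (Fin dA × Fin dB) (Fin dA × Fin dB) ℂ) (i : Fin m) :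
    (M.P i ⊗ₖ (1 : Matrix (Fin dB) (Fin dB) ℂ)) * dephAB σ M *
      (M.P i ⊗ₖ (1 : Matrix (Fin dB) (Fin dB) ℂ)) =
    (M.P i ⊗ₖ (1 : Matrix (Fin dB) (Fin dB) ℂ)) * σ *
      (M.P i ⊗ₖ (1 : Matrix (Fin dB) (Fin dB) ℂ)) := by
  rw [dephAB, Finset.mul_sum, Finset.sum_mul, Finset.sum_eq_single i]
  · simp only [← mul_assoc, M.kroneckerOne_mul_kroneckerOne, if_pos]
    rw [mul_assoc, M.kroneckerOne_mul_kroneckerOne, if_pos rfl]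
  · intro j _ hj
    simp only [← mul_assoc, M.kroneckerOne_mul_kroneckerOne, if_neg hj.symm, zero_mul]
  · simp

lemma cHV_dephAB (σ : Matrix (Fin dA × Fin dB) (Fin dA × Fin dB) ℂ) :
    cHV (dephAB σ M) M = cHV σ M := by
  have hp : ∀ i, prob (dephAB σ M) M i = prob σ M i := fun i => by
    simp only [prob, ← M.trace_outcome, M.outcome_dephAB]
  simp only [cHV, condB, hp, M.outcome_dephAB, M.ptraceA_dephAB]

end ProjMeas

/-- if `{P_i}` attains `C_HV(ρ)` then, for the dephased state `ρ'`,
the projectors commute with `ρ'_A`, `δ_cl^→(ρ',{P_i}) = c_HV(ρ',{P_i}) = C_HV(ρ)`,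
and consequently `Δ_cl^→(ρ') ≥ C_HV(ρ)`. -/
theorem dephAB_attains {dA dB m : ℕ}
    (ρ : Matrix (Fin dA × Fin dB) (Fin dA × Fin dB) ℂ) (hρ : IsDensityMatrix ρ)
    (M : ProjMeas dA m) (hM : M.Complete) (hopt : cHV ρ M = CHV ρ) :
    (∀ i, M.P i * ptraceB (dephAB ρ M) = ptraceB (dephAB ρ M) * M.P i) ∧
    deltaCl (dephAB ρ M) M = cHV (dephAB ρ M) M ∧
    cHV (dephAB ρ M) M = CHV ρ ∧
    DeltaCl (dephAB ρ M) ≥ CHV ρ := by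
  have hδ : deltaCl (dephAB ρ M) M = cHV (dephAB ρ M) M := by
    rw [deltaCl, M.ptraceB_dephAB, M.deph_deph, sub_self, zero_add]
  have hc : cHV (dephAB ρ M) M = CHV ρ := (M.cHV_dephAB ρ).trans hopt
  refine ⟨fun i => ?_, hδ, hc, ?_⟩
  · rw [M.ptraceB_dephAB, M.commute_deph]
  · refine le_csSup ⟨vnEntropy (ptraceB (dephAB ρ M)) + vnEntropy (ptraceA (dephAB ρ M)), ?_⟩
      ⟨m, M, hM, (hδ.trans hc).symm⟩
    rintro _ ⟨n, N, -, rfl⟩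
    exact N.deltaCl_le (M.isDensityMatrix_dephAB hρ)

end
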